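/- arXiv:1204.4290 — 5 statements merged into one kernel-verified Lean document; each statement's English description precedes it below -/
import Mathlib

section
/- There is no smooth field of symmetric bilinear forms that is everywhere non-degenerate and invariant under the second-Poincaré pseudo-translations. Precisely: let p ∈ ℝ⁴ with p ≠ 0 and let U be an open neighbourhood of p. Then there is no smooth map g : U → (symmetric 4×4 real matrices), x ↦ (g_{μν}(x)), such that (1) g_{μν}(x) is an invertible matrix for every x ∈ U, and (2) for every b ∈ ℝ⁴ the Lie derivative of g along the vector field ξ_b(x) = (b·x) x vanishes on U, i.e. ξ_b^λ ∂_λ g_{μν} + g_{μλ} ∂_ν ξ_b^λ + g_{λν} ∂_μ ξ_b^λ = 0 on U for all μ, ν. -/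
noncomputable section

open scoped BigOperators

/-- The Minkowski metric η = diag(1,−1,−1,−1), as a function of two indices. -/
def etaF : Fin 4 → Fin 4 → ℝ := fun μ ν => if μ = ν then (if μ = 0 then 1 else -1) else 0

/-- The Minkowski product x·y = η_{μν} x^μ y^ν. -/
def mdot (x y : Fin 4 → ℝ) : ℝ := ∑ μ, ∑ ν, etaF μ ν * x μ * y ν

/-- The lowered index x_μ = η_{μν} x^ν. -/
def lowr (x : Fin 4 → ℝ) (μ : Fin 4) : ℝ := ∑ ν, etaF μ ν * x ν

/-- The partial derivative ∂_λ f (x). -/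
def pdv (f : (Fin 4 → ℝ) → ℝ) (lam : Fin 4) (x : Fin 4 → ℝ) : ℝ :=
  fderiv ℝ f x (Pi.single lam 1)

/-- A ∈ 𝔰𝔬(1,3), i.e. Aᵀη + ηA = 0, written componentwise. -/
def so13 (A : Fin 4 → Fin 4 → ℝ) : Prop :=
  ∀ μ ν, (∑ κ, A κ μ * etaF κ ν) + (∑ κ, etaF μ κ * A κ ν) = 0

/-- The 𝔭₂ vector field ξ(x) = A x + (b·x) x. -/
def xiP2 (A : Fin 4 → Fin 4 → ℝ) (b : Fin 4 → ℝ) (x : Fin 4 → ℝ) : Fin 4 → ℝ :=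
  fun μ => (∑ ν, A μ ν * x ν) + mdot b x * x μ

/-- Lie derivative of a covariant symmetric 2-tensor field g along a vector field ξ:
  (ℒ_ξ g)_{μν} = ξ^λ ∂_λ g_{μν} + g_{μλ} ∂_ν ξ^λ + g_{λν} ∂_μ ξ^λ. -/
def lieG (ξf : (Fin 4 → ℝ) → Fin 4 → ℝ) (g : (Fin 4 → ℝ) → Fin 4 → Fin 4 → ℝ)
    (x : Fin 4 → ℝ) (μ ν : Fin 4) : ℝ :=
  (∑ lam, ξf x lam * pdv (fun y => g y μ ν) lam x)
  + (∑ lam, g x μ lam * pdv (fun y => ξf y lam) ν x)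
  + (∑ lam, g x lam ν * pdv (fun y => ξf y lam) μ x)

/-- Lie derivative of a contravariant symmetric 2-tensor field h along a vector field ξ:
  (ℒ_ξ h)^{μν} = ξ^λ ∂_λ h^{μν} − h^{μλ} ∂_λ ξ^ν − h^{λν} ∂_λ ξ^μ. -/
def lieH (ξf : (Fin 4 → ℝ) → Fin 4 → ℝ) (h : (Fin 4 → ℝ) → Fin 4 → Fin 4 → ℝ)
    (x : Fin 4 → ℝ) (μ ν : Fin 4) : ℝ :=
  (∑ lam, ξf x lam * pdv (fun y => h y μ ν) lam x)
  - (∑ lam, h x μ lam * pdv (fun y => ξf y ν) lam x)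
  - (∑ lam, h x lam ν * pdv (fun y => ξf y μ) lam x)

/-- Lie derivative of a connection Γ^μ_{νρ} along a vector field ξ ([ℒ_ξ, ∇]):
  ξ^λ ∂_λ Γ^μ_{νρ} − Γ^λ_{νρ} ∂_λ ξ^μ + Γ^μ_{λρ} ∂_ν ξ^λ + Γ^μ_{νλ} ∂_ρ ξ^λ + ∂_ν ∂_ρ ξ^μ. -/
def lieConn (ξf : (Fin 4 → ℝ) → Fin 4 → ℝ)
    (Γ : (Fin 4 → ℝ) → Fin 4 → Fin 4 → Fin 4 → ℝ)
    (x : Fin 4 → ℝ) (μ ν ρ : Fin 4) : ℝ :=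
  (∑ lam, ξf x lam * pdv (fun y => Γ y μ ν ρ) lam x)
  - (∑ lam, Γ x lam ν ρ * pdv (fun y => ξf y μ) lam x)
  + (∑ lam, Γ x μ lam ρ * pdv (fun y => ξf y lam) ν x)
  + (∑ lam, Γ x μ ν lam * pdv (fun y => ξf y lam) ρ x)
  + pdv (fun y => pdv (fun z => ξf z μ) ρ y) ν x

/-- The canonical degenerate covariant metric g_{μν}(x) = (x_μ x_ν − (x·x) η_{μν})/(x·x)². -/
def gC (x : Fin 4 → ℝ) (μ ν : Fin 4) : ℝ :=
  (lowr x μ * lowr x ν - mdot x x * etaF μ ν) / (mdot x x) ^ 2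

/-- The canonical degenerate contravariant metric h^{μν}(x) = (x·x) x^μ x^ν. -/
def hC (x : Fin 4 → ℝ) (μ ν : Fin 4) : ℝ := mdot x x * x μ * x ν

/-- The canonical connection Γ^μ_{νλ}(x) = −(x_ν δ^μ_λ + δ^μ_ν x_λ)/(x·x). -/
def GammaC (x : Fin 4 → ℝ) (μ ν lam : Fin 4) : ℝ :=
  -(lowr x ν * (if μ = lam then 1 else 0) + (if μ = ν then 1 else 0) * lowr x lam) / mdot x x

lemma mdot_eq (b y : Fin 4 → ℝ) : mdot b y = b 0 * y 0 - b 1 * y 1 - b 2 * y 2 - b 3 * y 3 := by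
  simp [mdot, etaF, Fin.sum_univ_four]
  ring

/-- The vector obtained from a covector by raising the index. -/
def raiseIdx (β : Fin 4 → ℝ) : Fin 4 → ℝ := fun k => if k = 0 then β 0 else - β k

lemma mdot_raise (β y : Fin 4 → ℝ) : mdot (raiseIdx β) y = ∑ k, β k * y k := by
  rw [mdot_eq, Fin.sum_univ_four]
  simp [raiseIdx]

lemma pdv_xi (β x : Fin 4 → ℝ) (hx : ∑ k, β k * x k = 0) (lam ν : Fin 4) :
    pdv (fun y => mdot (raiseIdx β) y * y lam) ν x = β ν * x lam := by
  unfold pdv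
  simp only [mdot_raise]
  have h1 : HasFDerivAt (fun y : Fin 4 → ℝ => ∑ k, β k * y k)
      (∑ k, β k • (ContinuousLinearMap.proj k : (Fin 4 → ℝ) →L[ℝ] ℝ)) x := by
    apply HasFDerivAt.fun_sum
    intro k _
    exact (hasFDerivAt_apply k x).const_mul (β k)
  have h2 := h1.mul (hasFDerivAt_apply lam x)
  have h3 : fderiv ℝ (fun y : Fin 4 → ℝ => (∑ k, β k * y k) * y lam) x = _ := h2.fderiv
  rw [h3, hx]
  simp [Pi.single_apply, mul_comm]

/-- No-go theorem: near any point p ≠ 0 there is no smooth, everywhere non-degenerate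
field of symmetric bilinear forms invariant under all 𝔭₂ pseudo-translations
ξ_b(x) = (b·x) x. -/
theorem stmt_0 (p : Fin 4 → ℝ) (hp : p ≠ 0) (U : Set (Fin 4 → ℝ))
    (hU : IsOpen U) (hpU : p ∈ U) :
    ¬ ∃ g : (Fin 4 → ℝ) → Fin 4 → Fin 4 → ℝ,
        (∀ μ ν, ContDiffOn ℝ (⊤ : ℕ∞) (fun x => g x μ ν) U) ∧
        (∀ x ∈ U, ∀ μ ν, g x μ ν = g x ν μ) ∧
        (∀ x ∈ U, (Matrix.of (g x)).det ≠ 0) ∧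
        (∀ b : Fin 4 → ℝ, ∀ x ∈ U, ∀ μ ν,
          lieG (fun y κ => mdot b y * y κ) g x μ ν = 0) := by
  rintro ⟨g, -, hs, hd, hL⟩
  obtain ⟨i, hi⟩ : ∃ i, p i ≠ 0 := by
    by_contra! h
    exact hp (funext h)
  obtain ⟨j, hj⟩ : ∃ j : Fin 4, j ≠ i := exists_ne i
  let β : Fin 4 → ℝ := Pi.single j (p i) - Pi.single i (p j)
  have hβ : ∑ k, β k * p k = 0 := by
    simp [β, sub_mul, Finset.sum_sub_distrib, Pi.single_apply]
    ring
  have hβj : β j ≠ 0 := by simpa [β, Pi.single_apply, hj] using hi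
  have key : ∀ μ ν, (∑ l, g p μ l * p l) * β ν + (∑ l, g p ν l * p l) * β μ = 0 := by
    intro μ ν
    have h := hL (raiseIdx β) p hpU μ ν
    unfold lieG at h
    simp only [pdv_xi β p hβ] at h
    simp only [mdot_raise, hβ, zero_mul, Finset.sum_const_zero, zero_add] at h
    rw [← h, Finset.sum_mul, Finset.sum_mul]
    congr 1
    · exact Finset.sum_congr rfl fun l _ => by ring
    · exact Finset.sum_congr rfl fun l _ => by rw [hs p hpU ν l]; ring
  have hvj : ∑ l, g p j l * p l = 0 := by
    have := key j j
    have h2 : (∑ l, g p j l * p l) * β j = 0 := by linarith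
    exact (mul_eq_zero.mp h2).resolve_right hβj
  have hv : Matrix.mulVec (Matrix.of (g p)) p = 0 := by
    funext μ
    have := key μ j
    rw [hvj, zero_mul, add_zero] at this
    exact (mul_eq_zero.mp this).resolve_right hβj
  exact hp (Matrix.eq_zero_of_mulVec_eq_zero (hd p hpU) hv)
end
end

section
/- Uniqueness of the 𝔭₂-invariant covariant metric on the region x·x < 0: let U = {x ∈ ℝ⁴ : x·x < 0}. If g : U → (symmetric 4×4 real matrices), x ↦ (g_{μν}(x)), is smooth and satisfies (ℒ_ξ g)_{μν} = 0 on U for every 𝔭₂ vector field ξ, then there exists a constant C ∈ ℝ such that g_{μν}(x) = C · (x_μ x_ν − (x·x) η_{μν}) / (x·x)² for all x ∈ U. -/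
noncomputable section

open scoped BigOperators

theorem eta_diag (i : Fin 4) : etaF i i = if i = 0 then 1 else -1 := by simp [etaF]

theorem lowr_eq (x : Fin 4 → ℝ) (i : Fin 4) : lowr x i = etaF i i * x i := by
  unfold lowr
  rw [Finset.sum_eq_single i]
  · intro j _ h; simp [etaF, h.symm]
  · simp

theorem mdot_eq_sum (x y : Fin 4 → ℝ) : mdot x y = ∑ i, lowr x i * y i := by
  unfold mdot
  refine Finset.sum_congr rfl fun i _ => ?_
  rw [lowr_eq, Finset.sum_eq_single i]
  · intro j _ h; simp [etaF, h.symm]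
  · simp

theorem mdot_self (x : Fin 4 → ℝ) : mdot x x = x 0 ^ 2 - x 1 ^ 2 - x 2 ^ 2 - x 3 ^ 2 := by
  rw [mdot_eq_sum]
  simp [Fin.sum_univ_four, lowr_eq, etaF]
  ring

theorem hasFDerivAt_lin (c : Fin 4 → ℝ) (x : Fin 4 → ℝ) :
    HasFDerivAt (fun y : Fin 4 → ℝ => ∑ i, c i * y i)
      (∑ i, c i • (ContinuousLinearMap.proj i : (Fin 4 → ℝ) →L[ℝ] ℝ)) x := by
  refine HasFDerivAt.fun_sum fun i _ => ?_
  exact (ContinuousLinearMap.proj (R := ℝ) (φ := fun _ : Fin 4 => ℝ) i).hasFDerivAt.const_mul (c i)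

theorem pdv_xi_s1 (A : Fin 4 → Fin 4 → ℝ) (b x : Fin 4 → ℝ) (l ν : Fin 4) :
    pdv (fun y => xiP2 A b y l) ν x
      = A l ν + lowr b ν * x l + mdot b x * (if l = ν then 1 else 0) := by
  unfold pdv xiP2
  simp only [mdot_eq_sum]
  have h := (hasFDerivAt_lin (A l) x).fun_add ((hasFDerivAt_lin (lowr b) x).fun_mul
    (ContinuousLinearMap.proj (R := ℝ) (φ := fun _ : Fin 4 => ℝ) l).hasFDerivAt)
  have h2 := h.fderiv
  simp only [ContinuousLinearMap.proj_apply] at h2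
  rw [h2]
  simp [Pi.single_apply]
  ring

theorem so13_wedge (u w : Fin 4 → ℝ) : so13 (fun l ν => u l * lowr w ν - w l * lowr u ν) := by
  intro μ ν
  simp only [Fin.sum_univ_four, lowr_eq]
  fin_cases μ <;> fin_cases ν <;> simp [etaF] <;> ring

/-- Pointwise consequences of the vanishing Lie derivatives. -/
theorem pointwise (x : Fin 4 → ℝ) (hx : mdot x x ≠ 0) (G : Fin 4 → Fin 4 → ℝ)
    (D : Fin 4 → Fin 4 → Fin 4 → ℝ) (hs : ∀ μ ν, G μ ν = G ν μ)
    (h : ∀ A : Fin 4 → Fin 4 → ℝ, ∀ b : Fin 4 → ℝ, so13 A → ∀ μ ν,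
      (∑ l, xiP2 A b x l * D l μ ν)
      + (∑ l, G μ l * (A l ν + lowr b ν * x l + mdot b x * (if l = ν then 1 else 0)))
      + (∑ l, G l ν * (A l μ + lowr b μ * x l + mdot b x * (if l = μ then 1 else 0))) = 0) :
    (∀ μ ν, 3 * mdot x x * G μ ν = - (G 0 0 - G 1 1 - G 2 2 - G 3 3) *
      (lowr x μ * lowr x ν - mdot x x * etaF μ ν)) ∧
    (∀ k, mdot x x * (D k 0 0 - D k 1 1 - D k 2 2 - D k 3 3)
      + 2 * lowr x k * (G 0 0 - G 1 1 - G 2 2 - G 3 3) = 0) := by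
  -- the abelian part
  have hb : ∀ β : Fin 4 → ℝ, ∀ μ ν,
      (∑ l, β l * x l) * ((∑ l, x l * D l μ ν) + 2 * G μ ν)
      + β ν * (∑ l, G μ l * x l) + β μ * (∑ l, G ν l * x l) = 0 := by
    intro β μ ν
    have h0 : so13 (fun _ _ => 0) := by intro μ ν; simp
    have h1 := h (fun _ _ => 0) (fun i => etaF i i * β i) h0 μ ν
    have hl : lowr (fun i => etaF i i * β i) = β := by
      funext i
      rw [lowr_eq, eta_diag]
      split_ifs <;> simp
    simp only [xiP2, mdot_eq_sum, hl] at h1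
    simp only [zero_mul, Finset.sum_const_zero, zero_add, mul_add, Finset.sum_add_distrib,
      mul_ite, mul_one, mul_zero, Finset.sum_ite_eq', Finset.mem_univ, if_true] at h1
    simp only [hs _ ν] at h1
    rw [hs μ ν]
    have e1 : ∑ l, (∑ i, β i * x i) * x l * D l μ ν = (∑ i, β i * x i) * ∑ l, x l * D l μ ν := by
      rw [Finset.mul_sum]; exact Finset.sum_congr rfl fun _ _ => by ring
    have e2 : ∀ a b, ∑ l, G a l * (β b * x l) = β b * ∑ l, G a l * x l := by
      intro a b
      rw [Finset.mul_sum]; exact Finset.sum_congr rfl fun _ _ => by ring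
    rw [e1, e2, e2] at h1
    linear_combination h1
  obtain ⟨i, hi⟩ : ∃ i, x i ≠ 0 := by
    by_contra! hc
    exact hx (by simp [mdot_self, hc])
  obtain ⟨k, hk⟩ : ∃ k : Fin 4, k ≠ i := exists_ne i
  have hv : ∀ μ, ∑ l, G μ l * x l = 0 := by
    have hz : ∑ l, (Pi.single k (x i) - Pi.single i (x k) : Fin 4 → ℝ) l * x l = 0 := by
      simp [sub_mul, Finset.sum_sub_distrib, Pi.single_apply]; ring
    have h1 := fun μ ν => hb (Pi.single k (x i) - Pi.single i (x k)) μ ν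
    simp only [hz, zero_mul, zero_add] at h1
    have hkk : (Pi.single k (x i) - Pi.single i (x k) : Fin 4 → ℝ) k = x i := by simp [hk]
    have h2 := h1 k k
    rw [hkk] at h2
    have h3 : ∑ l, G k l * x l = 0 := by
      have : x i * ∑ l, G k l * x l = 0 := by linarith
      exact (mul_eq_zero.1 this).resolve_left hi
    intro μ
    have h4 := h1 μ k
    rw [hkk, h3, mul_zero, add_zero] at h4
    exact (mul_eq_zero.1 h4).resolve_left hi
  have hE : ∀ μ ν, (∑ l, x l * D l μ ν) + 2 * G μ ν = 0 := by
    intro μ ν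
    have h1 := hb (Pi.single i 1) μ ν
    rw [hv, hv] at h1
    simp [Pi.single_apply] at h1
    exact h1.resolve_left hi
  -- the Lorentz part
  have hA : ∀ u w : Fin 4 → ℝ, ∀ μ ν,
      (∑ l, (u l * mdot w x - w l * mdot u x) * D l μ ν)
      + (∑ l, G μ l * u l) * lowr w ν - (∑ l, G μ l * w l) * lowr u ν
      + (∑ l, G ν l * u l) * lowr w μ - (∑ l, G ν l * w l) * lowr u μ = 0 := by
    intro u w μ ν
    have h1 := h _ 0 (so13_wedge u w) μ ν
    simp only [hs _ ν] at h1
    simp only [xiP2, mdot_eq_sum] at h1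
    simp [lowr_eq 0] at h1
    simp only [mdot_eq_sum]
    simp only [Fin.sum_univ_four] at h1 ⊢
    linear_combination h1
  have hn := mdot_self x
  constructor
  · -- algebraic identity
    set n := mdot x x with hndef
    have hK : ∀ a c p q, G p a * (n * etaF c q - lowr x c * lowr x q)
        - G p c * (n * etaF a q - lowr x a * lowr x q)
        + G q a * (n * etaF c p - lowr x c * lowr x p)
        - G q c * (n * etaF a p - lowr x a * lowr x p) = 0 := by
      intro a c p q
      have h1 := hA (fun l => n * (if l = a then 1 else 0) - lowr x a * x l)
        (fun l => n * (if l = c then 1 else 0) - lowr x c * x l) p q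
      have hm : ∀ a, mdot (fun l => n * (if l = a then 1 else 0) - lowr x a * x l) x = 0 := by
        intro a
        have : ∀ l, lowr (fun l => n * (if l = a then 1 else 0) - lowr x a * x l) l * x l
          = (if l = a then n * lowr x a else 0) - lowr x a * (lowr x l * x l) := by
          intro l
          simp only [lowr_eq]
          split_ifs with h
          · subst h; ring
          · ring
        rw [mdot_eq_sum, Finset.sum_congr rfl fun l _ => this l, Finset.sum_sub_distrib,
          ← Finset.mul_sum, ← mdot_eq_sum]
        simp [← hndef]; ring
      have hl : ∀ a p, lowr (fun l => n * (if l = a then 1 else 0) - lowr x a * x l) p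
          = n * etaF a p - lowr x a * lowr x p := by
        intro a p
        simp only [lowr_eq]
        by_cases hap : p = a
        · subst hap; simp; ring
        · have e : etaF a p = 0 := by simp [etaF, Ne.symm hap]
          rw [e, if_neg hap]; ring
      have hG : ∀ a p, ∑ l, G p l * (n * (if l = a then 1 else 0) - lowr x a * x l)
          = n * G p a := by
        intro a p
        have : ∀ l, G p l * (n * (if l = a then 1 else 0) - lowr x a * x l)
          = (if l = a then n * G p a else 0) - lowr x a * (G p l * x l) := by
          intro l
          split_ifs with h
          · subst h; ring
          · ring
        rw [Finset.sum_congr rfl fun l _ => this l, Finset.sum_sub_distrib,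
          ← Finset.mul_sum, hv]
        simp
      simp only [hm, hl, hG] at h1
      simp only [mul_zero, sub_zero, zero_mul, Finset.sum_const_zero, zero_add] at h1
      have h2 : n * (G p a * (n * etaF c q - lowr x c * lowr x q)
        - G p c * (n * etaF a q - lowr x a * lowr x q)
        + G q a * (n * etaF c p - lowr x c * lowr x p)
        - G q c * (n * etaF a p - lowr x a * lowr x p)) = 0 := by linear_combination h1
      exact (mul_eq_zero.1 h2).resolve_left hx
    intro p a
    have k0 := hK a 0 p 0
    have k1 := hK a 1 p 1
    have k2 := hK a 2 p 2
    have k3 := hK a 3 p 3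
    have va := hv a
    have vp := hv p
    have sa := hs p a
    rw [hs 0 a] at k0
    rw [hs 1 a] at k1
    rw [hs 2 a] at k2
    rw [hs 3 a] at k3
    clear_value n
    clear hK hA hE hv hb h
    simp only [Fin.sum_univ_four] at va vp
    have kk : 3 * n * G p a - (- (G 0 0 - G 1 1 - G 2 2 - G 3 3) *
      (lowr x p * lowr x a - n * etaF p a)) = 0 := by
      have ks : _ := congrArg₂ (· - ·) (congrArg₂ (· - ·) (congrArg₂ (· - ·) k0 k1) k2) k3
      have hlp : lowr x p = etaF p p * x p := lowr_eq x p
      have hla : lowr x a = etaF a a * x a := lowr_eq x a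
      simp only [lowr_eq] at *
      fin_cases p <;> fin_cases a <;> simp [etaF] at * <;> grind
    linarith
  · intro k
    have h1 := fun μ => hA (Pi.single k 1) x μ μ
    have h2 := fun μ => hE μ μ
    have hvk := hv k
    have hm : mdot (Pi.single k 1) x = lowr x k := by
      rw [mdot_eq_sum]
      simp only [lowr_eq]
      simp [Pi.single_apply]
    have hG : ∀ μ, ∑ l, G μ l * (Pi.single k 1 : Fin 4 → ℝ) l = G k μ := by
      intro μ
      rw [hs k μ]
      simp [Pi.single_apply]
    have hD : ∀ μ, ∑ l, ((Pi.single k 1 : Fin 4 → ℝ) l * mdot x x - x l * lowr x k) * D l μ μ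
        = mdot x x * D k μ μ - lowr x k * ∑ l, x l * D l μ μ := by
      intro μ
      rw [Finset.mul_sum]
      simp only [sub_mul, Finset.sum_sub_distrib]
      congr 1
      · simp [Pi.single_apply]
      · exact Finset.sum_congr rfl fun _ _ => by ring
    simp only [hm, hG, hv, hD, zero_mul, sub_zero] at h1
    have a0 := h1 0
    have a1 := h1 1
    have a2 := h1 2
    have a3 := h1 3
    have b0 := h2 0
    have b1 := h2 1
    have b2 := h2 2
    have b3 := h2 3
    have l0 : lowr x 0 = x 0 := by simp [lowr_eq, etaF]
    have l1 : lowr x 1 = - x 1 := by simp [lowr_eq, etaF]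
    have l2 : lowr x 2 = - x 2 := by simp [lowr_eq, etaF]
    have l3 : lowr x 3 = - x 3 := by simp [lowr_eq, etaF]
    rw [l0] at a0
    rw [l1] at a1
    rw [l2] at a2
    rw [l3] at a3
    rw [Fin.sum_univ_four] at hvk
    linear_combination a0 - a1 - a2 - a3 + lowr x k * (b0 - b1 - b2 - b3) - 2 * hvk

theorem isOpen_U : IsOpen {x : Fin 4 → ℝ | mdot x x < 0} := by
  simp only [mdot_self]
  exact isOpen_lt (by fun_prop) continuous_const

theorem preconn_U : IsPreconnected {x : Fin 4 → ℝ | mdot x x < 0} := by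
  have h1 : IsPreconnected ({0}ᶜ : Set (Fin 3 → ℝ)) := by
    refine (isConnected_compl_singleton_of_one_lt_rank ?_ 0).isPreconnected
    simp
  have h2 : IsPreconnected (Set.Ioo (-1 : ℝ) 1) := isPreconnected_Ioo
  have h3 := (h1.prod h2).image
    (fun p : (Fin 3 → ℝ) × ℝ => (![p.2 * √(p.1 0 ^ 2 + p.1 1 ^ 2 + p.1 2 ^ 2),
      p.1 0, p.1 1, p.1 2] : Fin 4 → ℝ)) (by
      refine Continuous.continuousOn (continuous_pi fun i => ?_)
      fin_cases i <;> simp <;> fun_prop)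
  convert h3 using 1
  ext x
  simp only [Set.mem_setOf_eq, mdot_self, Set.mem_image, Set.mem_prod, Set.mem_compl_iff,
    Set.mem_singleton_iff, Set.mem_Ioo, Prod.exists]
  constructor
  · intro hx
    have hr : 0 < x 1 ^ 2 + x 2 ^ 2 + x 3 ^ 2 := by nlinarith [sq_nonneg (x 0)]
    have hr2 := Real.sqrt_pos.2 hr
    have hlt : |x 0| < √(x 1 ^ 2 + x 2 ^ 2 + x 3 ^ 2) :=
      Real.lt_sqrt_of_sq_lt (by rw [sq_abs]; linarith)
    obtain ⟨ha, hb⟩ := abs_lt.1 hlt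
    refine ⟨![x 1, x 2, x 3], x 0 / √(x 1 ^ 2 + x 2 ^ 2 + x 3 ^ 2), ⟨?_, ?_, ?_⟩, ?_⟩
    · intro h
      have e0 := congrFun h 0
      have e1 := congrFun h 1
      have e2 := congrFun h 2
      simp at e0 e1 e2
      simp [e0, e1, e2] at hr
    · rw [lt_div_iff₀ hr2]; linarith
    · rw [div_lt_iff₀ hr2]; linarith
    · funext i
      fin_cases i <;> simp
      exact div_mul_cancel₀ _ hr2.ne'
  · rintro ⟨v, t, ⟨hv, h1, h2⟩, rfl⟩
    have hr : 0 < v 0 ^ 2 + v 1 ^ 2 + v 2 ^ 2 := by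
      by_contra hc
      apply hv
      have a0 := sq_nonneg (v 0)
      have a1 := sq_nonneg (v 1)
      have a2 := sq_nonneg (v 2)
      funext i
      fin_cases i
      · exact pow_eq_zero_iff (two_ne_zero) |>.1 (by linarith : v 0 ^ 2 = 0)
      · exact pow_eq_zero_iff (two_ne_zero) |>.1 (by linarith : v 1 ^ 2 = 0)
      · exact pow_eq_zero_iff (two_ne_zero) |>.1 (by linarith : v 2 ^ 2 = 0)
    simp [mul_pow, Real.sq_sqrt hr.le]
    have ht : t ^ 2 < 1 := by nlinarith
    nlinarith

/-- Uniqueness of the 𝔭₂-invariant covariant metric on the region x·x < 0. -/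
theorem stmt_1 (g : (Fin 4 → ℝ) → Fin 4 → Fin 4 → ℝ)
    (hsmooth : ∀ μ ν, ContDiffOn ℝ (⊤ : ℕ∞) (fun x => g x μ ν) {x : Fin 4 → ℝ | mdot x x < 0})
    (hsym : ∀ x ∈ {x : Fin 4 → ℝ | mdot x x < 0}, ∀ μ ν, g x μ ν = g x ν μ)
    (hinv : ∀ A : Fin 4 → Fin 4 → ℝ, ∀ b : Fin 4 → ℝ, so13 A →
      ∀ x ∈ {x : Fin 4 → ℝ | mdot x x < 0}, ∀ μ ν, lieG (xiP2 A b) g x μ ν = 0) :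
    ∃ C : ℝ, ∀ x ∈ {x : Fin 4 → ℝ | mdot x x < 0}, ∀ μ ν,
      g x μ ν = C * (lowr x μ * lowr x ν - mdot x x * etaF μ ν) / (mdot x x) ^ 2 := by
  have hU := isOpen_U
  have hdiff : ∀ x ∈ {x : Fin 4 → ℝ | mdot x x < 0}, ∀ μ ν,
      DifferentiableAt ℝ (fun y => g y μ ν) x := fun x hx μ ν =>
    ((hsmooth μ ν).contDiffAt (hU.mem_nhds hx)).differentiableAt (by simp)
  have hp : ∀ x ∈ {x : Fin 4 → ℝ | mdot x x < 0}, _ := fun x hx =>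
    pointwise x (ne_of_lt hx) (g x) (fun l μ ν => pdv (fun y => g y μ ν) l x) (hsym x hx) (by
      intro A b hA μ ν
      have := hinv A b hA x hx μ ν
      simpa only [lieG, pdv_xi_s1] using this)
  have hd : ∀ x ∈ {x : Fin 4 → ℝ | mdot x x < 0}, HasFDerivAt
      (fun y => mdot y y * (g y 0 0 - g y 1 1 - g y 2 2 - g y 3 3)) (0 : (Fin 4 → ℝ) →L[ℝ] ℝ) x := by
    intro x hx
    have hT := ((((hdiff x hx 0 0).hasFDerivAt.fun_sub (hdiff x hx 1 1).hasFDerivAt).fun_sub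
      (hdiff x hx 2 2).hasFDerivAt).fun_sub (hdiff x hx 3 3).hasFDerivAt)
    have hpr : ∀ i, HasFDerivAt (fun y : Fin 4 → ℝ => y i)
      (ContinuousLinearMap.proj (R := ℝ) (φ := fun _ : Fin 4 => ℝ) i) x := fun i =>
      (ContinuousLinearMap.proj (R := ℝ) (φ := fun _ : Fin 4 => ℝ) i).hasFDerivAt
    have hn := ((((hpr 0).pow 2).fun_sub ((hpr 1).pow 2)).fun_sub
      ((hpr 2).pow 2)).fun_sub ((hpr 3).pow 2)
    have hm : (fun y : Fin 4 → ℝ => mdot y y) = fun y => y 0 ^ 2 - y 1 ^ 2 - y 2 ^ 2 - y 3 ^ 2 :=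
      funext mdot_self
    rw [← hm] at hn
    have hf := hn.fun_mul hT
    refine hf.congr_fderiv ?_
    refine ContinuousLinearMap.coe_injective (LinearMap.pi_ext' fun k => LinearMap.ext_ring ?_)
    have h2 := (hp x hx).2 k
    simp only [pdv] at h2
    have hl : ∀ j : Fin 4, (Pi.single k 1 : Fin 4 → ℝ) j = if j = k then 1 else 0 := fun j => by
      simp [Pi.single_apply]
    have h3 : 2 * lowr x k = 2 * x 0 * (if (0 : Fin 4) = k then 1 else 0)
      - 2 * x 1 * (if (1 : Fin 4) = k then 1 else 0) - 2 * x 2 * (if (2 : Fin 4) = k then 1 else 0)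
      - 2 * x 3 * (if (3 : Fin 4) = k then 1 else 0) := by
      rw [lowr_eq]
      fin_cases k <;> simp [etaF]
    rw [h3] at h2
    simp [hl]
    simp at h2
    linear_combination h2
  obtain ⟨c, hc⟩ := hU.exists_is_const_of_fderiv_eq_zero preconn_U
    (fun x hx => (hd x hx).differentiableAt.differentiableWithinAt)
    (fun x hx => (hd x hx).fderiv)
  refine ⟨-c / 3, fun x hx μ ν => ?_⟩
  have h1 := (hp x hx).1 μ ν
  have h2 := hc x hx
  have h0 : mdot x x ≠ 0 := ne_of_lt hx
  beta_reduce at h2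
  rw [← h2]
  field_simp
  linear_combination h1
end
end

section
/- Invariance of the degenerate contravariant metric under the second Poincaré algebra: let U = {x ∈ ℝ⁴ : x·x ≠ 0} and define h^{μν}(x) = (x·x) x^μ x^ν on ℝ⁴. Then for every 𝔭₂ vector field ξ(x) = A x + (b·x) x (with A ∈ 𝔰𝔬(1,3) and b ∈ ℝ⁴), the Lie derivative of h along ξ vanishes: ξ^λ ∂_λ h^{μν} − h^{μλ} ∂_λ ξ^ν − h^{λν} ∂_λ ξ^μ = 0 for all μ, ν and all x. -/
noncomputable section

open scoped BigOperators

lemma mdot_expand (x y : Fin 4 → ℝ) :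
    mdot x y = x 0 * y 0 - x 1 * y 1 - x 2 * y 2 - x 3 * y 3 := by
  simp [mdot, etaF, Fin.sum_univ_four]
  ring

/-- Contracting partial derivatives with a vector gives the directional derivative. -/
lemma sum_pdv (f : (Fin 4 → ℝ) → ℝ) (x v : Fin 4 → ℝ) :
    ∑ lam, v lam * pdv f lam x = fderiv ℝ f x v := by
  conv_rhs => rw [pi_eq_sum_univ' v]
  simp [pdv, map_sum, smul_eq_mul]

lemma hasFDerivAt_coord (x : Fin 4 → ℝ) (i : Fin 4) :
    HasFDerivAt (fun y : Fin 4 → ℝ => y i) (ContinuousLinearMap.proj (R := ℝ) i) x :=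
  hasFDerivAt_apply i x

lemma fderiv_hC (x v : Fin 4 → ℝ) (μ ν : Fin 4) :
    fderiv ℝ (fun y => hC y μ ν) x v =
      2 * mdot x v * x μ * x ν + mdot x x * v μ * x ν + mdot x x * x μ * v ν := by
  have c := hasFDerivAt_coord x
  have h := ((((((c 0).mul (c 0)).sub ((c 1).mul (c 1))).sub ((c 2).mul (c 2))).sub
    ((c 3).mul (c 3))).mul (c μ)).mul (c ν)
  have e : (fun y => hC y μ ν) = fun y : Fin 4 → ℝ =>
      (y 0 * y 0 - y 1 * y 1 - y 2 * y 2 - y 3 * y 3) * y μ * y ν := by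
    funext y; rw [hC, mdot_expand]
  rw [e]
  refine (congrArg (fun L => L v) h.fderiv).trans ?_
  simp [mdot_expand]
  ring

lemma fderiv_xi (A : Fin 4 → Fin 4 → ℝ) (b x v : Fin 4 → ℝ) (μ : Fin 4) :
    fderiv ℝ (fun y => xiP2 A b y μ) x v =
      (∑ ν, A μ ν * v ν) + mdot b v * x μ + mdot b x * v μ := by
  have c := hasFDerivAt_coord x
  have k := fun (r : ℝ) i => (c i).const_mul r
  have h := ((((k (A μ 0) 0).add (k (A μ 1) 1)).add (k (A μ 2) 2)).add (k (A μ 3) 3)).add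
    (((((k (b 0) 0).sub (k (b 1) 1)).sub (k (b 2) 2)).sub (k (b 3) 3)).mul (c μ))
  have e : (fun y => xiP2 A b y μ) = fun y : Fin 4 → ℝ =>
      A μ 0 * y 0 + A μ 1 * y 1 + A μ 2 * y 2 + A μ 3 * y 3 +
      (b 0 * y 0 - b 1 * y 1 - b 2 * y 2 - b 3 * y 3) * y μ := by
    funext y; simp only [xiP2, mdot_expand, Fin.sum_univ_four]
  rw [e]
  refine (congrArg (fun L => L v) h.fderiv).trans ?_
  simp [mdot_expand, Fin.sum_univ_four]
  ring

lemma mdot_xi (A : Fin 4 → Fin 4 → ℝ) (hA : so13 A) (b x : Fin 4 → ℝ) :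
    mdot x (xiP2 A b x) = mdot b x * mdot x x := by
  have h00 := hA 0 0
  have h01 := hA 0 1
  have h02 := hA 0 2
  have h03 := hA 0 3
  have h11 := hA 1 1
  have h12 := hA 1 2
  have h13 := hA 1 3
  have h22 := hA 2 2
  have h23 := hA 2 3
  have h33 := hA 3 3
  simp [etaF, Fin.sum_univ_four] at h00 h01 h02 h03 h11 h12 h13 h22 h23 h33
  simp only [mdot_expand, xiP2, Fin.sum_univ_four]
  linear_combination x 0 * x 0 * h00 - x 1 * x 1 * h11 - x 2 * x 2 * h22
    - x 3 * x 3 * h33 + x 0 * x 1 * h01 + x 0 * x 2 * h02 + x 0 * x 3 * h03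
    + x 1 * x 2 * h12 + x 1 * x 3 * h13 + x 2 * x 3 * h23

/-- Invariance of the degenerate contravariant metric h^{μν} = (x·x) x^μ x^ν under the
second Poincaré algebra (the identity holds for all x). -/
theorem stmt_8 (A : Fin 4 → Fin 4 → ℝ) (hA : so13 A) (b : Fin 4 → ℝ) :
    ∀ x : Fin 4 → ℝ, ∀ μ ν, lieH (xiP2 A b) hC x μ ν = 0 := by
  intro x μ ν
  have e1 : ∀ lam, hC x μ lam = (mdot x x * x μ) * x lam := fun lam => rfl
  have e2 : ∀ lam, hC x lam ν = (mdot x x * x ν) * x lam := fun lam => by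
    rw [hC]; ring
  simp only [lieH, e1, e2, mul_assoc (mdot x x * x _), ← Finset.mul_sum, sum_pdv]
  rw [fderiv_hC, fderiv_xi, fderiv_xi, mdot_xi A hA]
  simp only [xiP2]
  ring
end
end

section
/- Metric compatibility of the canonical connection with the degenerate covariant metric: on U = {x ∈ ℝ⁴ : x·x ≠ 0}, with g_{μν}(x) = (x_μ x_ν − (x·x) η_{μν})/(x·x)² and Γ^μ_{νλ}(x) = −(x_ν δ^μ_λ + δ^μ_ν x_λ)/(x·x), one has ∇_λ g_{μν} := ∂_λ g_{μν} − Γ^κ_{λμ} g_{κν} − Γ^κ_{λν} g_{μκ} = 0 identically on U, for all indices λ, μ, ν. -/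
noncomputable section

open scoped BigOperators

/-- The lowered index as a continuous linear functional. -/
def lowrL (μ : Fin 4) : (Fin 4 → ℝ) →L[ℝ] ℝ :=
  ∑ ν, etaF μ ν • ContinuousLinearMap.proj (R := ℝ) (φ := fun _ : Fin 4 => ℝ) ν

theorem lowrL_apply (μ : Fin 4) (x : Fin 4 → ℝ) : lowrL μ x = lowr x μ := by
  simp [lowrL, lowr]

theorem lowr_single (μ lam : Fin 4) : lowr (Pi.single lam 1) μ = etaF μ lam := by
  simp [lowr, Pi.single_apply]

theorem etaF_comm (μ ν : Fin 4) : etaF μ ν = etaF ν μ := by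
  unfold etaF
  by_cases h : μ = ν
  · subst h; rfl
  · rw [if_neg h, if_neg (Ne.symm h)]

theorem hasFDerivAt_lowr (μ : Fin 4) (x : Fin 4 → ℝ) :
    HasFDerivAt (fun y => lowr y μ) (lowrL μ) x := by
  have h := (lowrL μ).hasFDerivAt (x := x)
  have e : (fun y => lowr y μ) = lowrL μ := by
    funext y; rw [lowrL_apply]
  rw [e]; exact h

theorem mdot_eq_s10 (x : Fin 4 → ℝ) : mdot x x = ∑ μ, x μ * lowr x μ := by
  unfold mdot lowr
  refine Finset.sum_congr rfl fun μ _ => ?_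
  rw [Finset.mul_sum]
  exact Finset.sum_congr rfl fun ν _ => by ring

theorem hasFDerivAt_mdot (x : Fin 4 → ℝ) :
    HasFDerivAt (fun y => mdot y y)
      ((2 : ℝ) • ∑ μ, x μ • lowrL μ) x := by
  have h : HasFDerivAt (fun y : Fin 4 → ℝ => ∑ μ, y μ * lowr y μ)
      (∑ μ, (x μ • lowrL μ +
        lowr x μ • ContinuousLinearMap.proj (R := ℝ) (φ := fun _ : Fin 4 => ℝ) μ)) x := by
    refine HasFDerivAt.fun_sum fun μ _ => ?_
    exact (hasFDerivAt_apply μ x).mul (hasFDerivAt_lowr μ x)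
  simp only [← mdot_eq_s10] at h
  convert h using 1
  ext v
  simp [lowrL_apply, lowr, etaF, Fin.sum_univ_four]
  ring

theorem sum_single (x : Fin 4 → ℝ) (lam : Fin 4) :
    ((2 : ℝ) • ∑ μ, x μ • lowrL μ) (Pi.single lam 1) = 2 * lowr x lam := by
  simp only [FunLike.coe_smul, FunLike.coe_sum, Pi.smul_apply, Finset.sum_apply, smul_eq_mul, lowrL_apply, lowr_single]
  unfold lowr
  congr 1
  exact Finset.sum_congr rfl fun ν _ => by rw [etaF_comm]; ring

theorem pdv_gC (x : Fin 4 → ℝ) (hx : mdot x x ≠ 0) (lam μ ν : Fin 4) :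
    pdv (fun y => gC y μ ν) lam x =
      (etaF μ lam * lowr x ν + lowr x μ * etaF ν lam - 2 * lowr x lam * etaF μ ν) / mdot x x ^ 2
      - 4 * lowr x lam * (lowr x μ * lowr x ν - mdot x x * etaF μ ν) / mdot x x ^ 3 := by
  have hm := hasFDerivAt_mdot x
  have hN := ((hasFDerivAt_lowr μ x).mul (hasFDerivAt_lowr ν x)).sub (hm.mul_const (etaF μ ν))
  have hD := hN.mul ((hasDerivAt_inv (pow_ne_zero 2 hx)).comp_hasFDerivAt x (hm.pow 2))
  have e := congrArg (fun L => L (Pi.single lam (1 : ℝ))) hD.fderiv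
  have hs := sum_single x lam
  set M := ((2 : ℝ) • ∑ μ, x μ • lowrL μ) with hM
  unfold pdv gC
  simp only [div_eq_mul_inv _ (mdot _ _ ^ 2)]
  refine Eq.trans e ?_
  simp [lowrL_apply, lowr_single, hs]
  field_simp
  ring

theorem sum_GammaC (x f : Fin 4 → ℝ) (lam μ : Fin 4) :
    ∑ κ, GammaC x κ lam μ * f κ = -(lowr x lam * f μ + lowr x μ * f lam) / mdot x x := by
  have : ∀ κ, GammaC x κ lam μ * f κ =
      (if κ = μ then -(lowr x lam * f κ) / mdot x x else 0)
      + (if κ = lam then -(lowr x μ * f κ) / mdot x x else 0) := by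
    intro κ
    unfold GammaC
    split_ifs <;> ring
  simp only [this, Finset.sum_add_distrib, Finset.sum_ite_eq', Finset.mem_univ, if_true]
  ring

/-- Metric compatibility of the canonical connection with the degenerate covariant
metric: ∇_λ g_{μν} = ∂_λ g_{μν} − Γ^κ_{λμ} g_{κν} − Γ^κ_{λν} g_{μκ} = 0 on x·x ≠ 0. -/
theorem stmt_10 :
    ∀ x : Fin 4 → ℝ, mdot x x ≠ 0 → ∀ lam μ ν : Fin 4,
      pdv (fun y => gC y μ ν) lam x
        - (∑ κ, GammaC x κ lam μ * gC x κ ν)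
        - (∑ κ, GammaC x κ lam ν * gC x μ κ) = 0 := by
  intro x hx lam μ ν
  rw [pdv_gC x hx, sum_GammaC x (fun κ => gC x κ ν), sum_GammaC x (fun κ => gC x μ κ)]
  simp only [gC]
  rw [etaF_comm lam ν, etaF_comm ν lam, etaF_comm lam ν]
  field_simp
  ring
end
end

section
/- Compatibility of the canonical connection with the degenerate contravariant metric: on U = {x ∈ ℝ⁴ : x·x ≠ 0}, with h^{μν}(x) = (x·x) x^μ x^ν and Γ^μ_{νλ}(x) = −(x_ν δ^μ_λ + δ^μ_ν x_λ)/(x·x), one has ∇_λ h^{μν} := ∂_λ h^{μν} + Γ^μ_{λκ} h^{κν} + Γ^ν_{λκ} h^{μκ} = 0 identically on U, for all indices λ, μ, ν. -/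
noncomputable section

open scoped BigOperators

theorem mdot_self_eq (y : Fin 4 → ℝ) : mdot y y = y 0 * y 0 - y 1 * y 1 - y 2 * y 2 - y 3 * y 3 := by
  simp [mdot, etaF, Fin.sum_univ_four]
  ring

theorem pdv_hC (x : Fin 4 → ℝ) (lam μ ν : Fin 4) :
    pdv (fun y => hC y μ ν) lam x = 2 * lowr x lam * x μ * x ν
      + mdot x x * (if μ = lam then 1 else 0) * x ν
      + mdot x x * x μ * (if ν = lam then 1 else 0) := by
  have hp : ∀ i : Fin 4, HasFDerivAt (fun y : Fin 4 → ℝ => y i)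
      (ContinuousLinearMap.proj (R := ℝ) (φ := fun _ : Fin 4 => ℝ) i) x :=
    fun i => hasFDerivAt_apply i x
  have h := ((((((hp 0).mul (hp 0)).sub ((hp 1).mul (hp 1))).sub ((hp 2).mul (hp 2))).sub
    ((hp 3).mul (hp 3))).mul (hp μ)).mul (hp ν)
  have e : (fun y => hC y μ ν) = fun y : Fin 4 → ℝ =>
      (y 0 * y 0 - y 1 * y 1 - y 2 * y 2 - y 3 * y 3) * y μ * y ν := by
    funext y
    rw [hC, mdot_self_eq]
  have h2 := h.fderiv
  rw [pdv, e]
  erw [h2]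
  rw [mdot_self_eq]
  have hl : lowr x lam = x 0 * (if 0 = lam then 1 else 0) - x 1 * (if 1 = lam then 1 else 0)
      - x 2 * (if 2 = lam then 1 else 0) - x 3 * (if 3 = lam then 1 else 0) := by
    fin_cases lam <;> simp [lowr, etaF, Fin.sum_univ_four]
  rw [hl]
  simp only [ContinuousLinearMap.add_apply, ContinuousLinearMap.sub_apply,
    ContinuousLinearMap.smul_apply, ContinuousLinearMap.proj_apply, Pi.single_apply, smul_eq_mul,
    Pi.mul_apply, Pi.sub_apply]
  ring

theorem lowr_sum (x : Fin 4 → ℝ) : ∑ κ, lowr x κ * x κ = mdot x x := by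
  rw [mdot_self_eq]
  simp [lowr, etaF, Fin.sum_univ_four]
  ring

theorem GammaC_sum (x : Fin 4 → ℝ) (hx : mdot x x ≠ 0) (lam μ ν : Fin 4) :
    ∑ κ, GammaC x μ lam κ * hC x κ ν
      = -(lowr x lam * x μ * x ν + (if μ = lam then 1 else 0) * mdot x x * x ν) := by
  have h : ∀ κ, GammaC x μ lam κ * hC x κ ν
      = -(lowr x lam * x ν * (if μ = κ then x κ else 0)
        + (if μ = lam then 1 else 0) * x ν * (lowr x κ * x κ)) := by
    intro κ
    unfold GammaC hC
    split_ifs <;> field_simp <;> ring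
  simp only [h, Finset.sum_neg_distrib, Finset.sum_add_distrib, ← Finset.mul_sum, lowr_sum]
  rw [Finset.sum_ite_eq]
  simp only [Finset.mem_univ, if_true]
  ring

theorem hC_symm (x : Fin 4 → ℝ) (μ ν : Fin 4) : hC x μ ν = hC x ν μ := by
  unfold hC
  ring

/-- Compatibility of the canonical connection with the degenerate contravariant
metric: ∇_λ h^{μν} = ∂_λ h^{μν} + Γ^μ_{λκ} h^{κν} + Γ^ν_{λκ} h^{μκ} = 0 on x·x ≠ 0. -/
theorem stmt_11 :
    ∀ x : Fin 4 → ℝ, mdot x x ≠ 0 → ∀ lam μ ν : Fin 4,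
      pdv (fun y => hC y μ ν) lam x
        + (∑ κ, GammaC x μ lam κ * hC x κ ν)
        + (∑ κ, GammaC x ν lam κ * hC x μ κ) = 0 := by
  intro x hx lam μ ν
  have h : ∑ κ, GammaC x ν lam κ * hC x μ κ = ∑ κ, GammaC x ν lam κ * hC x κ μ :=
    Finset.sum_congr rfl fun κ _ => by rw [hC_symm]
  rw [h, GammaC_sum x hx, GammaC_sum x hx, pdv_hC]
  ring
end
end
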